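/- Let k be a positive integer. Every virtual knot K is related to the virtual knot K(a) for some integer a with 0 ≤ a < k by a finite sequence of 2k-moves and Ξ-moves. -/

import Mathlib

/-!
Combinatorial Gauss diagrams.

A Gauss diagram is encoded as a list of chord endpoints read along the
oriented circle from a basepoint.  Each endpoint records the (natural number)
label of its chord, whether it is the terminal endpoint of the (oriented)
chord, and the sign of the chord (`true` = +1, `false` = -1).
Diagrams are considered up to rotation of the basepoint and relabeling of the
chords; these renamings are included among the "Reidemeister" generators.
-/

structure Endpoint where
  label : ℕ
  isTerminal : Bool
  sign : Bool
deriving DecidableEq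

namespace Gauss

/-- The sign (±1) of the chord through an endpoint. -/
def signValue (e : Endpoint) : ℤ := if e.sign then 1 else -1

/-- The sign assigned to an endpoint: `ε` at the terminal endpoint and `-ε`
at the initial endpoint of a chord of sign `ε`. -/
def endpointValue (e : Endpoint) : ℤ := if e.isTerminal then signValue e else -signValue e

/-- The list of chord labels of the endpoints of a word. -/
def labels (L : List Endpoint) : List ℕ := L.map Endpoint.label

/-- A word is a Gauss diagram when every chord label occurring in it occurs
exactly twice, once as an initial and once as a terminal endpoint, with the
same sign at both occurrences. -/
def IsGaussDiagram (L : List Endpoint) : Prop :=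
  ∀ e ∈ L, (L.filter (fun x => x.label == e.label)).length = 2 ∧
    ∃ e' ∈ L, e'.label = e.label ∧ e'.isTerminal = !e.isTerminal ∧ e'.sign = e.sign

/-- Rotate a word so that the first endpoint satisfying `p` comes first. -/
def rotateTo (L : List Endpoint) (p : Endpoint → Bool) : List Endpoint :=
  match L.findIdx? p with
  | some i => L.drop i ++ L.take i
  | none => L

/-- The index of the chord labeled `c`: the sum of the signs assigned to the
endpoints on the arc running from the initial endpoint of the chord to its
terminal endpoint in the direction of the circle's orientation. -/
def chordIndex (L : List Endpoint) (c : ℕ) : ℤ :=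
  ((((rotateTo L (fun e => e.label == c && !e.isTerminal)).drop 1).takeWhile
      (fun e => e.label != c)).map endpointValue).sum

/-- `Jn L n`: the sum of the signs of the chords of `L` of index `n`. -/
def Jn (L : List Endpoint) (n : ℤ) : ℤ :=
  ((L.filter (fun e => e.isTerminal && decide (chordIndex L e.label = n))).map signValue).sum

/-- The odd writhe: the sum of the signs of the chords of odd index,
i.e. `J = Σ_{n odd} J_n`. -/
def oddWrithe (L : List Endpoint) : ℤ :=
  ((L.filter (fun e => e.isTerminal && decide (chordIndex L e.label % 2 ≠ 0))).map signValue).sum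

/-- Moving the basepoint of the circle. -/
def rotateStep (L L' : List Endpoint) : Prop :=
  ∃ x xs, L = x :: xs ∧ L' = xs ++ [x]

/-- Injective relabeling of the chords. -/
def relabelStep (L L' : List Endpoint) : Prop :=
  ∃ f : ℕ → ℕ, Function.Injective f ∧
    L' = L.map (fun e => Endpoint.mk (f e.label) e.isTerminal e.sign)

/-- Reidemeister move I (removal direction): remove an isolated chord whose
two endpoints are adjacent (either orientation, either sign). -/
def reid1 (L L' : List Endpoint) : Prop :=
  ∃ (A B : List Endpoint) (c : ℕ) (t s : Bool),
    c ∉ labels (A ++ B) ∧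
    L = A ++ [Endpoint.mk c t s, Endpoint.mk c (!t) s] ++ B ∧
    L' = A ++ B

/-- Reidemeister move II (removal direction): remove two chords of opposite
signs whose initial endpoints are adjacent and whose terminal endpoints are
adjacent (in either of the two admissible orders). -/
def reid2 (L L' : List Endpoint) : Prop :=
  ∃ (A B C : List Endpoint) (c d : ℕ) (s crossed : Bool),
    c ≠ d ∧ c ∉ labels (A ++ B ++ C) ∧ d ∉ labels (A ++ B ++ C) ∧
    L = A ++ [Endpoint.mk c false s, Endpoint.mk d false (!s)] ++ B ++
        (if crossed then [Endpoint.mk c true s, Endpoint.mk d true (!s)]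
         else [Endpoint.mk d true (!s), Endpoint.mk c true s]) ++ C ∧
    L' = A ++ B ++ C

/-- Reidemeister move III (a standard variant; together with the moves I, II,
rotations and relabelings it generates all versions of the third move). -/
def reid3 (L L' : List Endpoint) : Prop :=
  ∃ (A B C D : List Endpoint) (a b c : ℕ) (s : Bool),
    a ≠ b ∧ b ≠ c ∧ a ≠ c ∧
    L = A ++ [Endpoint.mk b false s, Endpoint.mk a false s] ++ B ++
        [Endpoint.mk a true s, Endpoint.mk c false (!s)] ++ C ++
        [Endpoint.mk b true s, Endpoint.mk c true (!s)] ++ D ∧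
    L' = A ++ [Endpoint.mk a false s, Endpoint.mk b false s] ++ B ++
        [Endpoint.mk c false (!s), Endpoint.mk a true s] ++ C ++
        [Endpoint.mk c true (!s), Endpoint.mk b true s] ++ D

/-- A single Reidemeister generator (including diagram renamings). -/
def reidStep (L L' : List Endpoint) : Prop :=
  rotateStep L L' ∨ relabelStep L L' ∨ reid1 L L' ∨ reid2 L L' ∨ reid3 L L'

/-- A Ξ-move: exchange the first and third of three consecutive endpoints
belonging to three distinct chords, keeping all signs and orientations. -/
def xiStep (L L' : List Endpoint) : Prop :=
  ∃ (A B : List Endpoint) (x y z : Endpoint),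
    x.label ≠ y.label ∧ y.label ≠ z.label ∧ x.label ≠ z.label ∧
    L = A ++ [x, y, z] ++ B ∧
    L' = A ++ [z, y, x] ++ B

/-- A 2k-move (removal direction): remove `2k` chords `c 0, …, c (2k-1)`, all
of sign `s`, whose `p`-endpoints appear consecutively on one arc and whose
`q`-endpoints appear consecutively on a disjoint arc, the chord `c i` being
oriented from `p` to `q` for even `i` (the paper's odd `i`, 1-indexed) and
from `q` to `p` for odd `i`, so initial and terminal endpoints alternate. -/
def move2k (k : ℕ) (L L' : List Endpoint) : Prop :=
  ∃ (A B C : List Endpoint) (c : ℕ → ℕ) (s : Bool),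
    (∀ i < 2 * k, ∀ j < 2 * k, c i = c j → i = j) ∧
    (∀ i < 2 * k, c i ∉ labels (A ++ B ++ C)) ∧
    L = A ++ (List.range (2 * k)).map (fun i => Endpoint.mk (c i) (decide (i % 2 = 1)) s)
          ++ B ++
        (List.range (2 * k)).map (fun i => Endpoint.mk (c i) (decide (i % 2 = 0)) s)
          ++ C ∧
    L' = A ++ B ++ C

/-- A crossing change: reverse the sign and the orientation of one chord. -/
def crossingChange (L L' : List Endpoint) : Prop :=
  ∃ c : ℕ,
    L' = L.map (fun e =>
      if e.label = c then Endpoint.mk e.label (!e.isTerminal) (!e.sign) else e)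

/-- Finite sequences of moves from `r`, performed in either direction. -/
def Moves (r : List Endpoint → List Endpoint → Prop) :
    List Endpoint → List Endpoint → Prop :=
  Relation.ReflTransGen (fun L L' => r L L' ∨ r L' L)

/-- Related by Reidemeister moves: the two words represent the same virtual knot. -/
def ReidEquiv : List Endpoint → List Endpoint → Prop := Moves reidStep

/-- Related by a finite sequence of 2k-moves (and Reidemeister moves). -/
def Rel2k (k : ℕ) : List Endpoint → List Endpoint → Prop :=
  Moves (fun L L' => reidStep L L' ∨ move2k k L L')

/-- Related by a finite sequence of Ξ-moves (and Reidemeister moves). -/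
def RelXi : List Endpoint → List Endpoint → Prop :=
  Moves (fun L L' => reidStep L L' ∨ xiStep L L')

/-- Related by a finite sequence of 2k-moves and Ξ-moves (and Reidemeister moves). -/
def Rel2kXi (k : ℕ) : List Endpoint → List Endpoint → Prop :=
  Moves (fun L L' => reidStep L L' ∨ move2k k L L' ∨ xiStep L L')

/-- Related by a finite sequence of crossing changes and Ξ-moves
(and Reidemeister moves). -/
def RelCCXi : List Endpoint → List Endpoint → Prop :=
  Moves (fun L L' => reidStep L L' ∨ crossingChange L L' ∨ xiStep L L')

/-- A shell-pair of sign `s`: two chords `c`, `d` of sign `s` whose four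
endpoints are consecutive, interleaved as 1st-3rd and 2nd-4th
(with arbitrary orientations `t`, `u` of the two shells). -/
def shellPair (c d : ℕ) (t u s : Bool) : List Endpoint :=
  [Endpoint.mk c t s, Endpoint.mk d u s, Endpoint.mk c (!t) s, Endpoint.mk d (!u) s]

/-- The Gauss diagram `G(a)`: `|a|` consecutive shell-pairs of sign `+1` if
`a > 0` and of sign `-1` if `a < 0`; `G(0)` has no chords.  It represents the
virtual knot `K(a)`. -/
def Gword (a : ℤ) : List Endpoint :=
  ((List.range a.natAbs).map
    (fun j => shellPair (2 * j) (2 * j + 1) false false (decide (0 < a)))).flatten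

/-- `Rel2kCount k m G G'`: `G` and `G'` are related by a finite sequence of
Reidemeister moves and exactly `m` 2k-moves. -/
inductive Rel2kCount (k : ℕ) : ℕ → List Endpoint → List Endpoint → Prop
  | refl (L : List Endpoint) : Rel2kCount k 0 L L
  | reid {m : ℕ} {L L' L'' : List Endpoint} :
      reidStep L L' ∨ reidStep L' L →
      Rel2kCount k m L' L'' → Rel2kCount k m L L''
  | move {m : ℕ} {L L' L'' : List Endpoint} :
      move2k k L L' ∨ move2k k L' L →
      Rel2kCount k m L' L'' → Rel2kCount k (m + 1) L L''

/-- The 2k-move distance: the minimal number of 2k-moves needed to relate the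
two diagrams (together with Reidemeister moves). -/
noncomputable def dist2k (k : ℕ) (L L' : List Endpoint) : ℕ :=
  sInf {m | Rel2kCount k m L L'}

end Gauss

namespace Gauss

section NormalForm

/-- The other endpoint of the chord through `e`. -/
def fl (e : Endpoint) : Endpoint := ⟨e.label, !e.isTerminal, e.sign⟩

@[simp] theorem fl_fl (e : Endpoint) : fl (fl e) = e := by cases e; simp [fl]
@[simp] theorem fl_label (e : Endpoint) : (fl e).label = e.label := rfl
@[simp] theorem fl_sign (e : Endpoint) : (fl e).sign = e.sign := rfl
@[simp] theorem fl_isTerminal (e : Endpoint) : (fl e).isTerminal = !e.isTerminal := rfl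
@[simp] theorem sv_fl (e : Endpoint) : signValue (fl e) = signValue e := rfl

/-! ### Basic moves -/

theorem E_symm {k : ℕ} {L L' : List Endpoint} (h : Rel2kXi k L L') : Rel2kXi k L' L := by
  induction h with
  | refl => exact Relation.ReflTransGen.refl
  | tail _ h2 ih => exact Relation.ReflTransGen.head h2.symm ih

theorem E_trans {k : ℕ} {L L' L'' : List Endpoint} (h : Rel2kXi k L L')
    (h' : Rel2kXi k L' L'') : Rel2kXi k L L'' := Relation.ReflTransGen.trans h h'

theorem E_refl {k : ℕ} (L : List Endpoint) : Rel2kXi k L L := Relation.ReflTransGen.refl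

theorem E_of_eq {k : ℕ} {L L' : List Endpoint} (h : L = L') : Rel2kXi k L L' := h ▸ E_refl L

theorem E_xi {k : ℕ} (A B : List Endpoint) (x y z : Endpoint)
    (h1 : x.label ≠ y.label) (h2 : y.label ≠ z.label) (h3 : x.label ≠ z.label) :
    Rel2kXi k (A ++ x :: y :: z :: B) (A ++ z :: y :: x :: B) := by
  apply Relation.ReflTransGen.single
  left; right; right
  exact ⟨A, B, x, y, z, h1, h2, h3, by simp, by simp⟩

theorem E_rot {k : ℕ} (A B : List Endpoint) : Rel2kXi k (A ++ B) (B ++ A) := by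
  induction A generalizing B with
  | nil => simpa using E_refl B
  | cons x A ih =>
    have h1 : Rel2kXi k (x :: (A ++ B)) (A ++ B ++ [x]) :=
      Relation.ReflTransGen.single (Or.inl (Or.inl (Or.inl ⟨x, A ++ B, rfl, rfl⟩)))
    have h2 := ih (B ++ [x])
    refine E_trans h1 ?_
    simpa using h2

theorem E_r1 {k : ℕ} (A B : List Endpoint) (c : Endpoint) (h : c.label ∉ labels (A ++ B)) :
    Rel2kXi k (A ++ c :: fl c :: B) (A ++ B) := by
  apply Relation.ReflTransGen.single
  left; left; right; right; left
  exact ⟨A, B, c.label, c.isTerminal, c.sign, h, by simp [fl], rfl⟩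

theorem E_relabel {k : ℕ} (L : List Endpoint) (f : ℕ → ℕ)
    (hf : ∀ a ∈ labels L, ∀ b ∈ labels L, f a = f b → a = b) :
    Rel2kXi k L (L.map (fun e => Endpoint.mk (f e.label) e.isTerminal e.sign)) := by
  classical
  have hS : ∀ a ∈ labels L, f a ≤ ((labels L).map f).sum := fun a ha =>
    List.le_sum_of_mem (List.mem_map_of_mem ha)
  apply Relation.ReflTransGen.single
  left; left; right; left
  refine ⟨fun n => if n ∈ labels L then f n else n + (((labels L).map f).sum + 1), ?_, ?_⟩
  · intro a b hab
    by_cases ha : a ∈ labels L <;> by_cases hb : b ∈ labels L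
    · simp only [ha, hb, if_true] at hab
      exact hf a ha b hb hab
    · simp only [ha, hb, if_true, if_false] at hab
      have := hS a ha
      omega
    · simp only [ha, hb, if_true, if_false] at hab
      have := hS b hb
      omega
    · simp only [ha, hb, if_false] at hab
      omega
  · apply List.map_congr_left
    intro e he
    have : e.label ∈ labels L := List.mem_map_of_mem he
    simp [this]

/-! ### Shell words -/

/-- The concatenation of the shell-pairs in `l`. -/
def W : List (Endpoint × Endpoint) → List Endpoint
  | [] => []
  | p :: l => p.1 :: p.2 :: fl p.1 :: fl p.2 :: W l

/-- The labels of the chords of a shell word. -/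
def labs : List (Endpoint × Endpoint) → List ℕ
  | [] => []
  | p :: l => p.1.label :: p.2.label :: labs l

/-- The sum of signs of the chords of a shell word. -/
def vl : List (Endpoint × Endpoint) → ℤ
  | [] => 0
  | p :: l => signValue p.1 + signValue p.2 + vl l

theorem W_append (l m : List (Endpoint × Endpoint)) : W (l ++ m) = W l ++ W m := by
  induction l with
  | nil => rfl
  | cons p l ih => simp [W, ih]

theorem labs_append (l m : List (Endpoint × Endpoint)) : labs (l ++ m) = labs l ++ labs m := by
  induction l with
  | nil => rfl
  | cons p l ih => simp [labs, ih]

theorem vl_append (l m : List (Endpoint × Endpoint)) : vl (l ++ m) = vl l + vl m := by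
  induction l with
  | nil => simp [vl]
  | cons p l ih => simp [vl, ih]; ring

theorem labs_perm {l m : List (Endpoint × Endpoint)} (h : l.Perm m) :
    (labs l).Perm (labs m) := by
  induction h with
  | nil => exact List.Perm.refl _
  | cons p _ ih => exact (ih.cons _).cons _
  | swap p q l =>
    simp only [labs]
    exact List.perm_append_comm_assoc [_, _] [_, _] _
  | trans _ _ h1 h2 => exact h1.trans h2

theorem vl_perm {l m : List (Endpoint × Endpoint)} (h : l.Perm m) : vl l = vl m := by
  induction h with
  | nil => rfl
  | cons p _ ih => simp [vl, ih]
  | swap p q l => simp only [vl]; ring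
  | trans _ _ h1 h2 => exact h1.trans h2

theorem mem_W {l : List (Endpoint × Endpoint)} {n : ℕ} :
    n ∈ labels (W l) ↔ n ∈ labs l := by
  induction l with
  | nil => simp [W, labs, labels]
  | cons p l ih =>
    simp only [labels, W, labs, List.map_cons, List.mem_cons, fl_label] at ih ⊢
    rw [ih]; tauto

theorem labs_swap_perm (l : List (Endpoint × Endpoint)) :
    (labs (l.map Prod.swap)).Perm (labs l) := by
  induction l with
  | nil => exact List.Perm.refl _
  | cons p l ih =>
    simp only [labs, List.map_cons, Prod.fst_swap, Prod.snd_swap]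
    exact (List.Perm.swap _ _ _).trans ((ih.cons _).cons _)

theorem vl_swap (l : List (Endpoint × Endpoint)) : vl (l.map Prod.swap) = vl l := by
  induction l with
  | nil => rfl
  | cons p l ih => simp [vl, ih]; ring

/-- Exchange two adjacent blocks of length two. -/
theorem E_block {k : ℕ} (A B : List Endpoint) (a b x y : Endpoint)
    (h1 : a.label ≠ b.label) (h2 : a.label ≠ x.label) (h3 : a.label ≠ y.label)
    (h4 : b.label ≠ x.label) (h5 : b.label ≠ y.label) (_h6 : x.label ≠ y.label) :
    Rel2kXi k (A ++ a :: b :: x :: y :: B) (A ++ x :: y :: a :: b :: B) := by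
  have e1 := E_xi (k := k) A (y :: B) a b x h1 h4 h2
  have e2 := E_xi (k := k) (A ++ [x]) B b a y h1.symm h3 h5
  refine E_trans e1 ?_
  simpa using e2

/-- Exchange the first shells of two adjacent shell-pairs. -/
theorem E_oswap {k : ℕ} (A B : List Endpoint) (c a b d : Endpoint)
    (hca : c.label ≠ a.label) (hcb : c.label ≠ b.label) (hcd : c.label ≠ d.label)
    (hab : a.label ≠ b.label) (_had : a.label ≠ d.label) (hbd : b.label ≠ d.label) :
    Rel2kXi k (A ++ c :: a :: fl c :: fl a :: b :: d :: fl b :: fl d :: B)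
      (A ++ b :: a :: fl b :: fl a :: c :: d :: fl c :: fl d :: B) := by
  have e1 := E_xi (k := k) (A ++ [c, a]) (d :: fl b :: fl d :: B) (fl c) (fl a) b hca hab hcb
  have e2 := E_xi (k := k) (A ++ [c, a, b, fl a]) (fl d :: B) (fl c) d (fl b) hcd hbd.symm hcb
  have e3 := E_xi (k := k) A (fl a :: fl b :: d :: fl c :: fl d :: B) c a b hca hab hcb
  have e4 := E_xi (k := k) (A ++ [b, a]) (d :: fl c :: fl d :: B) c (fl a) (fl b) hca hab hcb
  simp only [List.append_assoc, List.cons_append, List.nil_append] at e1 e2 e3 e4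
  exact E_trans e1 (E_trans e2 (E_trans e3 e4))

/-- Exchange the second shells of two adjacent shell-pairs. -/
theorem E_eswap {k : ℕ} (A B : List Endpoint) (c a b d : Endpoint)
    (hca : c.label ≠ a.label) (_hcb : c.label ≠ b.label) (hcd : c.label ≠ d.label)
    (hab : a.label ≠ b.label) (had : a.label ≠ d.label) (hbd : b.label ≠ d.label) :
    Rel2kXi k (A ++ c :: a :: fl c :: fl a :: b :: d :: fl b :: fl d :: B)
      (A ++ c :: d :: fl c :: fl d :: b :: a :: fl b :: fl a :: B) := by
  have e1 := E_xi (k := k) (A ++ [c, a, fl c]) (fl b :: fl d :: B) (fl a) b d hab hbd had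
  have e2 := E_xi (k := k) (A ++ [c, a, fl c, d, b]) B (fl a) (fl b) (fl d) hab hbd had
  have e3 := E_xi (k := k) (A ++ [c]) (b :: fl d :: fl b :: fl a :: B) a (fl c) d hca.symm hcd had
  have e4 := E_xi (k := k) (A ++ [c, d, fl c]) (fl b :: fl a :: B) a b (fl d) hab hbd had
  simp only [List.append_assoc, List.cons_append, List.nil_append] at e1 e2 e3 e4
  exact E_trans e1 (E_trans e2 (E_trans e3 e4))

theorem E_perm {k : ℕ} {l m : List (Endpoint × Endpoint)} (h : l.Perm m)
    (A : List Endpoint) (hl : (labs l).Nodup) : Rel2kXi k (A ++ W l) (A ++ W m) := by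
  induction h generalizing A with
  | nil => exact E_refl _
  | cons p _ ih =>
    simp only [labs, List.nodup_cons] at hl
    have := ih (A ++ [p.1, p.2, fl p.1, fl p.2]) hl.2.2
    simpa [W] using this
  | swap p q l =>
    obtain ⟨x, y⟩ := p
    obtain ⟨z, w⟩ := q
    simp only [labs, List.nodup_cons, List.mem_cons, not_or] at hl
    obtain ⟨⟨h1, h2, h3, -⟩, ⟨h4, h5, -⟩, ⟨h6, -⟩, -⟩ := hl
    refine E_trans (E_oswap A (W l) z w x y h1 h2 h3 h4 h5 h6) ?_
    exact E_eswap A (W l) x w z y (Ne.symm h4) (Ne.symm h2) h6 (Ne.symm h1) h5 h3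
  | trans h1 _ ih1 ih2 =>
    exact E_trans (ih1 A hl) (ih2 A ((labs_perm h1).nodup_iff.1 hl))

theorem E_move {k : ℕ} (l : List (Endpoint × Endpoint)) (c : Endpoint)
    (A B : List Endpoint) (hl : (labs l).Nodup) (hc : c.label ∉ labs l) :
    Rel2kXi k (A ++ (W l ++ c :: B)) (A ++ c :: (W (l.map Prod.swap) ++ B)) := by
  induction l generalizing A with
  | nil => simpa [W] using E_refl _
  | cons p l ih =>
    obtain ⟨x, y⟩ := p
    simp only [labs, List.nodup_cons, List.mem_cons, not_or] at hl hc
    obtain ⟨⟨h1, -⟩, -, h2⟩ := hl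
    obtain ⟨h3, h4, h5⟩ := hc
    have e1 := ih (A ++ [x, y, fl x, fl y]) h2 h5
    have e2 := E_xi (k := k) (A ++ [x, y]) (W (l.map Prod.swap) ++ B) (fl x) (fl y) c
      h1 (Ne.symm h4) (Ne.symm h3)
    have e3 := E_xi (k := k) A (fl y :: fl x :: (W (l.map Prod.swap) ++ B)) x y c
      h1 (Ne.symm h4) (Ne.symm h3)
    simp only [List.append_assoc, List.cons_append, List.nil_append, W, List.map_cons,
      Prod.fst_swap, Prod.snd_swap] at e1 e2 e3 ⊢
    exact E_trans e1 (E_trans e2 e3)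

theorem E_rot1 {k : ℕ} (l : List (Endpoint × Endpoint)) (c a : Endpoint)
    (hl : (labs ((c, a) :: l)).Nodup) :
    Rel2kXi k (W ((c, a) :: l)) (W ((a, fl c) :: l.map Prod.swap)) := by
  have e1 := E_rot (k := k) [c] (a :: fl c :: fl a :: W l)
  simp only [labs, List.nodup_cons, List.mem_cons, not_or] at hl
  have e2 := E_move (k := k) l c [a, fl c, fl a] [] hl.2.2 hl.1.2
  simp only [List.cons_append, List.nil_append, W, fl_fl, List.append_nil] at e1 e2 ⊢
  exact E_trans e1 e2

theorem E_flip2 {k : ℕ} (l : List (Endpoint × Endpoint)) (c a : Endpoint)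
    (hl : (labs ((c, a) :: l)).Nodup) :
    Rel2kXi k (W ((c, a) :: l)) (W ((fl c, fl a) :: l)) := by
  refine E_trans (E_rot1 l c a hl) ?_
  have h := E_rot1 (k := k) (l.map Prod.swap) a (fl c) (by
    have h2 := labs_swap_perm l
    simp only [labs, List.nodup_cons, List.mem_cons, not_or, fl_label, h2.mem_iff,
      h2.nodup_iff] at hl ⊢
    tauto)
  simpa using h

/-- Flip the first shells of two shell-pairs. -/
theorem E_oflip {k : ℕ} (l : List (Endpoint × Endpoint)) (c a b d : Endpoint)
    (hl : (labs ((c, a) :: (b, d) :: l)).Nodup) :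
    Rel2kXi k (W ((c, a) :: (b, d) :: l)) (W ((fl c, a) :: (fl b, d) :: l)) := by
  have hl' := hl
  simp only [labs, List.nodup_cons, List.mem_cons, not_or] at hl'
  obtain ⟨⟨h1, h2, h3, h3'⟩, ⟨h4, h5, h5'⟩, ⟨h6, h6'⟩, h7, h8⟩ := hl'
  have e1 := E_flip2 (k := k) _ c a hl
  have e2 := E_oswap (k := k) [] (W l) (fl c) (fl a) b d h1 h2 h3 h4 h5 h6
  have e3 := E_flip2 (k := k) ((fl c, d) :: l) b (fl a) (by
    simp only [labs, List.nodup_cons, List.mem_cons, not_or, fl_label]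
    tauto)
  have e4 := E_oswap (k := k) [] (W l) (fl b) a (fl c) d (Ne.symm h4) (Ne.symm h2) h6
    (Ne.symm h1) h5 h3
  simp only [List.nil_append, W, fl_fl] at e1 e2 e3 e4 ⊢
  exact E_trans e1 (E_trans e2 (E_trans e3 e4))

/-- Flip the second shells of two shell-pairs. -/
theorem E_eflip {k : ℕ} (l : List (Endpoint × Endpoint)) (c a b d : Endpoint)
    (hl : (labs ((c, a) :: (b, d) :: l)).Nodup) :
    Rel2kXi k (W ((c, a) :: (b, d) :: l)) (W ((c, fl a) :: (b, fl d) :: l)) := by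
  have e1 := E_oflip (k := k) l c a b d hl
  have e2 := E_flip2 (k := k) ((fl b, d) :: l) (fl c) a hl
  have hl2 : (labs ((b, d) :: (c, a) :: l)).Nodup :=
    (labs_perm (List.Perm.swap _ _ _)).nodup_iff.1 hl
  have e3 := E_perm (k := k) (List.Perm.swap (fl b, d) (fl (fl c), fl a) l) [] hl
  have e4 := E_flip2 (k := k) ((fl (fl c), fl a) :: l) (fl b) d hl2
  have e5 := E_perm (k := k) (List.Perm.swap (fl (fl c), fl a) (fl (fl b), fl d) l) [] hl2
  simp only [List.nil_append, fl_fl] at e1 e2 e3 e4 e5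
  exact E_trans e1 (E_trans e2 (E_trans (E_symm (E_symm e3)) (E_trans e4 e5)))

/-! ### Normalising orientations -/

theorem orient_aux {k : ℕ} (l : List (Endpoint × Endpoint)) :
    ∀ (p : Endpoint × Endpoint) (r : List (Endpoint × Endpoint)),
    (labs (p :: l ++ r)).Nodup →
    (∀ q ∈ r, q.1.isTerminal = false ∧ q.2.isTerminal = false) →
    ∃ p' l', (labs (p' :: l')).Nodup ∧ vl (p' :: l') = vl (p :: l ++ r) ∧
      (∀ q ∈ l', q.1.isTerminal = false ∧ q.2.isTerminal = false) ∧
      Rel2kXi k (W (p :: l ++ r)) (W (p' :: l')) := by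
  induction l with
  | nil =>
    intro p r h1 h2
    exact ⟨p, r, h1, rfl, h2, E_refl _⟩
  | cons q l ih =>
    intro p r h1 h2
    -- first make the shells of `q` point in the standard direction
    have step : ∃ p1 q1, (labs (p1 :: q1 :: (l ++ r))).Nodup ∧
        vl (p1 :: q1 :: (l ++ r)) = vl (p :: q :: (l ++ r)) ∧
        q1.1.isTerminal = false ∧ q1.2.isTerminal = false ∧
        Rel2kXi k (W (p :: q :: (l ++ r))) (W (p1 :: q1 :: (l ++ r))) := by
      obtain ⟨x, y⟩ := p
      obtain ⟨z, w⟩ := q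
      have s1 : ∃ x1 z1, x1.label = x.label ∧ z1.label = z.label ∧
          signValue x1 = signValue x ∧ signValue z1 = signValue z ∧ z1.isTerminal = false ∧
          Rel2kXi k (W ((x, y) :: (z, w) :: (l ++ r))) (W ((x1, y) :: (z1, w) :: (l ++ r))) := by
        cases hz : z.isTerminal
        · exact ⟨x, z, rfl, rfl, rfl, rfl, hz, E_refl _⟩
        · exact ⟨fl x, fl z, rfl, rfl, rfl, rfl, by simp [hz], E_oflip _ x y z w h1⟩
      obtain ⟨x1, z1, a1, a2, a3, a4, a5, a6⟩ := s1
      have h1' : (labs ((x1, y) :: (z1, w) :: (l ++ r))).Nodup := by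
        simpa only [labs, a1, a2, List.cons_append] using h1
      have s2 : ∃ y1 w1, y1.label = y.label ∧ w1.label = w.label ∧
          signValue y1 = signValue y ∧ signValue w1 = signValue w ∧ w1.isTerminal = false ∧
          Rel2kXi k (W ((x1, y) :: (z1, w) :: (l ++ r)))
            (W ((x1, y1) :: (z1, w1) :: (l ++ r))) := by
        cases hz : w.isTerminal
        · exact ⟨y, w, rfl, rfl, rfl, rfl, hz, E_refl _⟩
        · exact ⟨fl y, fl w, rfl, rfl, rfl, rfl, by simp [hz], E_eflip _ x1 y z1 w h1'⟩
      obtain ⟨y1, w1, b1, b2, b3, b4, b5, b6⟩ := s2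
      refine ⟨(x1, y1), (z1, w1), ?_, ?_, a5, b5, E_trans a6 b6⟩
      · simpa only [labs, b1, b2] using h1'
      · simp only [vl, a3, a4, b3, b4]
    obtain ⟨p1, q1, c1, c2, c3, c4, c5⟩ := step
    have hp : (p1 :: q1 :: (l ++ r)).Perm (p1 :: l ++ (q1 :: r)) :=
      (List.perm_middle.symm).cons _
    obtain ⟨p', l', d1, d2, d3, d4⟩ := ih p1 (q1 :: r) ((labs_perm hp).nodup_iff.1 c1) (by
      intro t ht
      rcases List.mem_cons.1 ht with rfl | ht
      · exact ⟨c3, c4⟩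
      · exact h2 t ht)
    refine ⟨p', l', d1, ?_, d3, ?_⟩
    · rw [d2, ← vl_perm hp, c2]; rfl
    · exact E_trans c5 (E_trans (E_perm hp [] c1) d4)

theorem orient {k : ℕ} (l : List (Endpoint × Endpoint)) (hl : (labs l).Nodup) :
    ∃ l', (labs l').Nodup ∧ vl l' = vl l ∧
      (∀ q ∈ l', q.1.isTerminal = false ∧ q.2.isTerminal = false) ∧
      Rel2kXi k (W l) (W l') := by
  cases l with
  | nil => exact ⟨[], hl, rfl, by simp, E_refl _⟩
  | cons p l =>
    obtain ⟨⟨x, y⟩, l', h1, h2, h3, h4⟩ := orient_aux (k := k) l p [] (by simpa using hl) (by simp)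
    simp only [List.append_nil] at h2 h4
    have hsw : ∀ q ∈ l'.map Prod.swap, q.1.isTerminal = false ∧ q.2.isTerminal = false := by
      intro q hq
      obtain ⟨q', hq', rfl⟩ := List.mem_map.1 hq
      exact (h3 q' hq').symm
    have h1s : (labs ((y, fl x) :: l'.map Prod.swap)).Nodup := by
      have h5 := labs_swap_perm l'
      simp only [labs, List.nodup_cons, List.mem_cons, not_or, fl_label, h5.mem_iff,
        h5.nodup_iff] at h1 ⊢
      tauto
    have h2s : vl ((y, fl x) :: l'.map Prod.swap) = vl (p :: l) := by
      rw [← h2]; simp only [vl, vl_swap, sv_fl]; ring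
    cases hx : x.isTerminal <;> cases hy : y.isTerminal
    · exact ⟨_, h1, h2, by simpa [hx, hy] using h3, h4⟩
    · refine ⟨(fl y, fl (fl x)) :: l'.map Prod.swap, h1s, h2s, ?_,
        E_trans h4 (E_trans (E_rot1 _ _ _ h1) (E_flip2 _ _ _ h1s))⟩
      intro q hq
      rcases List.mem_cons.1 hq with rfl | hq
      · simp [hx, hy]
      · exact hsw q hq
    · refine ⟨(y, fl x) :: l'.map Prod.swap, h1s, h2s, ?_, E_trans h4 (E_rot1 _ _ _ h1)⟩
      intro q hq
      rcases List.mem_cons.1 hq with rfl | hq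
      · simp [hx, hy]
      · exact hsw q hq
    · refine ⟨(fl x, fl y) :: l', h1, h2, ?_, E_trans h4 (E_flip2 _ _ _ h1)⟩
      intro q hq
      rcases List.mem_cons.1 hq with rfl | hq
      · simp [hx, hy]
      · exact h3 q hq

/-! ### Cancelling signs -/

theorem E_cancel {k : ℕ} (l : List (Endpoint × Endpoint)) (x y : Endpoint)
    (hl : (labs ((x, y) :: l)).Nodup) (hx : x.isTerminal = false) (hy : y.isTerminal = false)
    (hs : y.sign = !x.sign) : Rel2kXi k (W ((x, y) :: l)) (W l) := by
  simp only [labs, List.nodup_cons, List.mem_cons, not_or] at hl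
  obtain ⟨c, t, s⟩ := x
  obtain ⟨d, u, s'⟩ := y
  simp only at hx hy hs hl
  subst hx hy hs
  apply Relation.ReflTransGen.single
  left; left; right; right; right; left
  refine ⟨[], [], W l, c, d, s, true, hl.1.1, ?_, ?_, by simp [W, fl], by simp⟩
  · simpa [mem_W] using hl.1.2
  · simpa [mem_W] using hl.2.1

theorem sv_cancel (x y : Endpoint) (hs : y.sign = !x.sign) : signValue x + signValue y = 0 := by
  unfold signValue
  rw [hs]
  cases x.sign <;> simp

theorem uniform {k : ℕ} (n : ℕ) : ∀ l : List (Endpoint × Endpoint), l.length ≤ n →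
    (labs l).Nodup → (∀ q ∈ l, q.1.isTerminal = false ∧ q.2.isTerminal = false) →
    ∃ l', (labs l').Nodup ∧ vl l' = vl l ∧
      (∃ s, ∀ q ∈ l', (q.1.isTerminal = false ∧ q.2.isTerminal = false) ∧
        q.1.sign = s ∧ q.2.sign = s) ∧
      Rel2kXi k (W l) (W l') := by
  induction n with
  | zero =>
    intro l hn _ _
    have : l = [] := List.eq_nil_of_length_eq_zero (by omega)
    subst this
    exact ⟨[], by simp [labs], rfl, ⟨true, by simp⟩, E_refl _⟩
  | succ n ih =>
    intro l hn hl ht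
    by_cases h1 : ∃ q ∈ l, q.2.sign = !q.1.sign
    · obtain ⟨⟨x, y⟩, hq, hs⟩ := h1
      have hp := List.perm_cons_erase hq
      have hl2 := (labs_perm hp).nodup_iff.1 hl
      have e1 := E_perm (k := k) hp [] hl
      have e2 := E_cancel (k := k) _ x y hl2 (ht _ hq).1 (ht _ hq).2 hs
      have hlen := hp.length_eq
      simp only [List.length_cons] at hlen
      obtain ⟨l', a1, a2, a3, a4⟩ := ih (l.erase (x, y)) (by omega)
        (by simp only [labs, List.nodup_cons] at hl2; exact hl2.2.2)
        (fun q hq => ht q (List.mem_of_mem_erase hq))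
      refine ⟨l', a1, ?_, a3, E_trans e1 (E_trans e2 a4)⟩
      rw [a2, vl_perm hp]
      have := sv_cancel x y hs
      simp only [vl]
      omega
    · have h1' : ∀ q ∈ l, q.2.sign = q.1.sign := by
        intro q hq
        by_contra hne
        apply h1
        refine ⟨q, hq, ?_⟩
        revert hne
        cases q.1.sign <;> cases q.2.sign <;> simp
      cases l with
      | nil => exact ⟨[], by simp [labs], rfl, ⟨true, by simp⟩, E_refl _⟩
      | cons p l =>
        obtain ⟨x, y⟩ := p
        by_cases h2 : ∃ q ∈ l, q.1.sign = !x.sign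
        · obtain ⟨⟨z, w⟩, hq, hs⟩ := h2
          have hp : ((x, y) :: l).Perm ((x, y) :: (z, w) :: l.erase (z, w)) :=
            (List.perm_cons_erase hq).cons _
          have hl2 := (labs_perm hp).nodup_iff.1 hl
          have hl3 := hl2
          simp only [labs, List.nodup_cons, List.mem_cons, not_or] at hl3
          obtain ⟨⟨b1, b2, b3, b3'⟩, ⟨b4, b5, b5'⟩, ⟨b6, b6'⟩, b7, b8⟩ := hl3
          have hxy := h1' (x, y) (by simp)
          have hzw := h1' (z, w) (by simp [hq])
          have txy := ht (x, y) (by simp)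
          have tzw := ht (z, w) (by simp [hq])
          simp only at hxy hzw hs txy tzw
          have e1 := E_perm (k := k) hp [] hl
          have e2 := E_oswap (k := k) [] (W (l.erase (z, w))) x y z w b1 b2 b3 b4 b5 b6
          have e3 := E_cancel (k := k) ((x, w) :: l.erase (z, w)) z y (by
            simp only [labs, List.nodup_cons, List.mem_cons, not_or]
            tauto) tzw.1 txy.2 (by rw [hxy, hs]; simp)
          have e4 := E_cancel (k := k) (l.erase (z, w)) x w (by
            simp only [labs, List.nodup_cons, List.mem_cons, not_or]
            tauto) txy.1 tzw.2 (by rw [hzw, hs])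
          have hlen := hp.length_eq
          simp only [List.length_cons] at hlen hn
          obtain ⟨l', a1, a2, a3, a4⟩ := ih (l.erase (z, w)) (by omega) b8
            (fun q hq => ht q (List.mem_cons_of_mem _ (List.mem_of_mem_erase hq)))
          refine ⟨l', a1, ?_, a3, E_trans e1 (E_trans e2 (E_trans e3 (E_trans e4 a4)))⟩
          rw [a2, vl_perm hp]
          have i1 := sv_cancel x w (by rw [hzw, hs])
          have i2 := sv_cancel z y (by rw [hxy, hs]; simp)
          simp only [vl]
          omega
        · refine ⟨_, hl, rfl, ⟨x.sign, ?_⟩, E_refl _⟩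
          intro q hq
          have hs : q.1.sign = x.sign := by
            rcases List.mem_cons.1 hq with rfl | hq
            · rfl
            · by_contra hne
              apply h2
              refine ⟨q, hq, ?_⟩
              revert hne
              cases q.1.sign <;> cases x.sign <;> simp
          exact ⟨ht q hq, hs, (h1' q hq).trans hs⟩

/-! ### Comparison with the standard diagrams -/

/-- The list of standard shell-pairs. -/
def gl (m : ℕ) (s : Bool) : List (Endpoint × Endpoint) :=
  (List.range m).map (fun j => (Endpoint.mk (2 * j) false s, Endpoint.mk (2 * j + 1) false s))

theorem gl_succ (m : ℕ) (s : Bool) : gl (m + 1) s =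
    gl m s ++ [(Endpoint.mk (2 * m) false s, Endpoint.mk (2 * m + 1) false s)] := by
  simp [gl, List.range_succ]

theorem Gword_eq (a : ℤ) : Gword a = W (gl a.natAbs (decide (0 < a))) := by
  unfold Gword
  generalize decide (0 < a) = s
  generalize a.natAbs = m
  induction m with
  | zero => rfl
  | succ m ih =>
    rw [gl_succ, W_append, ← ih, List.range_succ]
    simp [W, shellPair, fl]

theorem labs_gl (m : ℕ) (s : Bool) : labs (gl m s) = List.range (2 * m) := by
  induction m with
  | zero => rfl
  | succ m ih =>
    rw [gl_succ, labs_append, ih, show 2 * (m + 1) = 2 * m + 1 + 1 by ring, List.range_succ,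
      List.range_succ]
    simp [labs]

theorem vl_uniform (l : List (Endpoint × Endpoint)) (s : Bool)
    (h : ∀ q ∈ l, q.1.sign = s ∧ q.2.sign = s) :
    vl l = 2 * (l.length * (if s then 1 else -1)) := by
  induction l with
  | nil => simp [vl]
  | cons p l ih =>
    have h1 := h p (by simp)
    rw [vl, ih (fun q hq => h q (List.mem_cons_of_mem _ hq))]
    simp only [signValue, h1.1, h1.2, List.length_cons]
    push_cast
    ring

theorem exists_map (l m : List ℕ) (hl : l.Nodup) (hm : m.Nodup) (h : l.length = m.length) :
    ∃ f : ℕ → ℕ, l.map f = m ∧ ∀ a ∈ l, ∀ b ∈ l, f a = f b → a = b := by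
  have hf : l.map (fun n => m.getD (l.idxOf n) 0) = m := by
    apply List.ext_getElem
    · simpa using h
    · intro i h1 h2
      simp only [List.length_map] at h1
      simp [hl.idxOf_getElem i h1, h2]
  refine ⟨_, hf, ?_⟩
  exact List.inj_on_of_nodup_map (by rw [hf]; exact hm)

theorem W_map (f : ℕ → ℕ) (s : Bool) (l m : List (Endpoint × Endpoint))
    (hl : ∀ q ∈ l, (q.1.isTerminal = false ∧ q.2.isTerminal = false) ∧
        q.1.sign = s ∧ q.2.sign = s)
    (hm : ∀ q ∈ m, (q.1.isTerminal = false ∧ q.2.isTerminal = false) ∧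
        q.1.sign = s ∧ q.2.sign = s)
    (h : (labs l).map f = labs m) :
    (W l).map (fun e => Endpoint.mk (f e.label) e.isTerminal e.sign) = W m := by
  induction l generalizing m with
  | nil =>
    cases m with
    | nil => rfl
    | cons q m => simp [labs] at h
  | cons p l ih =>
    cases m with
    | nil => simp [labs] at h
    | cons q m =>
      simp only [labs, List.map_cons, List.cons.injEq] at h
      have h1 := hl p (by simp)
      have h2 := hm q (by simp)
      have h3 := ih m (fun q hq => hl q (List.mem_cons_of_mem _ hq))
        (fun q hq => hm q (List.mem_cons_of_mem _ hq)) h.2.2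
      obtain ⟨⟨a1, a2, a3⟩, ⟨b1, b2, b3⟩⟩ := p
      obtain ⟨⟨c1, c2, c3⟩, ⟨d1, d2, d3⟩⟩ := q
      simp only at h h1 h2
      simp [W, h3, fl, h, h1, h2]

theorem labs_length (l : List (Endpoint × Endpoint)) : (labs l).length = 2 * l.length := by
  induction l with
  | nil => rfl
  | cons p l ih => simp [labs, ih]; ring

theorem toG {k : ℕ} (l : List (Endpoint × Endpoint)) (hl : (labs l).Nodup) :
    ∃ a : ℤ, vl l = 2 * a ∧ Rel2kXi k (W l) (Gword a) := by
  obtain ⟨l1, a1, a2, a3, a4⟩ := orient (k := k) l hl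
  obtain ⟨l2, b1, b2, ⟨s, b3⟩, b4⟩ := uniform (k := k) _ l1 le_rfl a1 a3
  refine ⟨l2.length * (if s then 1 else -1), ?_, E_trans a4 (E_trans b4 ?_)⟩
  · rw [← a2, ← b2]
    exact vl_uniform l2 s (fun q hq => (b3 q hq).2)
  · have hg : Gword (l2.length * (if s then 1 else -1)) = W (gl l2.length s) := by
      rw [Gword_eq]
      cases hlen : l2.length with
      | zero => simp [gl]
      | succ n =>
        have hpos : ¬ (0 : ℤ) < -((n : ℤ) + 1) := by omega
        have hpos2 : (0 : ℤ) < (n : ℤ) + 1 := by omega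
        have hn1 : (-1 + -(n : ℤ)).natAbs = n + 1 := by omega
        have hn2 : ((n : ℤ) + 1).natAbs = n + 1 := by omega
        have hn3 : (-((n : ℤ) + 1)).natAbs = n + 1 := by omega
        cases s
        · simp only [Bool.false_eq_true, if_false, mul_neg, mul_one, Nat.cast_add, Nat.cast_one,
            hpos, hn3, decide_false]
        · simp only [if_true, mul_one, Nat.cast_add, Nat.cast_one, hpos2, hn2, decide_true]
    rw [hg]
    obtain ⟨f, f1, f2⟩ := exists_map (labs l2) (labs (gl l2.length s)) b1
      (by rw [labs_gl]; exact List.nodup_range) (by rw [labs_gl, labs_length]; simp)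
    rw [← W_map f s l2 _ b3 (by simp [gl]) f1]
    apply E_relabel
    intro a ha b hb
    exact f2 a (mem_W.1 ha) b (mem_W.1 hb)

/-! ### The effect of the 2k-move -/

/-- First endpoints. -/
def PP : List (Endpoint × Endpoint) → List Endpoint
  | [] => []
  | p :: l => p.1 :: p.2 :: PP l

/-- Second endpoints. -/
def QQ : List (Endpoint × Endpoint) → List Endpoint
  | [] => []
  | p :: l => fl p.1 :: fl p.2 :: QQ l

theorem PP_append (l m : List (Endpoint × Endpoint)) : PP (l ++ m) = PP l ++ PP m := by
  induction l with
  | nil => rfl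
  | cons p l ih => simp [PP, ih]

theorem QQ_append (l m : List (Endpoint × Endpoint)) : QQ (l ++ m) = QQ l ++ QQ m := by
  induction l with
  | nil => rfl
  | cons p l ih => simp [QQ, ih]

theorem E_moveBlock {k : ℕ} (l : List (Endpoint × Endpoint)) (A B : List Endpoint)
    (x y : Endpoint) (hl : (labs ((x, y) :: l)).Nodup) :
    Rel2kXi k (A ++ (PP l ++ x :: y :: B)) (A ++ x :: y :: (PP l ++ B)) := by
  induction l generalizing A with
  | nil => simpa [PP] using E_refl _
  | cons p l ih =>
    obtain ⟨z, w⟩ := p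
    simp only [labs, List.nodup_cons, List.mem_cons, not_or] at hl ih
    obtain ⟨⟨h1, h2, h3, h3'⟩, ⟨h4, h5, h5'⟩, ⟨h6, h6'⟩, h7, h8⟩ := hl
    have e1 := ih (A ++ [z, w]) ⟨⟨h1, h3'⟩, h5', h8⟩
    have e2 := E_block (k := k) A (PP l ++ B) z w x y h6 (Ne.symm h2) (Ne.symm h4) (Ne.symm h3)
      (Ne.symm h5) h1
    simp only [PP, List.append_assoc, List.cons_append, List.nil_append] at e1 e2 ⊢
    exact E_trans e1 e2

theorem E_PQ {k : ℕ} (l : List (Endpoint × Endpoint)) (A : List Endpoint)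
    (hl : (labs l).Nodup) : Rel2kXi k (A ++ (PP l ++ QQ l)) (A ++ W l) := by
  induction l generalizing A with
  | nil => exact E_refl _
  | cons p l ih =>
    obtain ⟨x, y⟩ := p
    have e1 := E_moveBlock (k := k) l (A ++ [x, y]) (QQ l) (fl x) (fl y) hl
    simp only [labs, List.nodup_cons] at hl
    have e2 := ih (A ++ [x, y, fl x, fl y]) hl.2.2
    simp only [PP, QQ, W, List.append_assoc, List.cons_append, List.nil_append] at e1 e2 ⊢
    exact E_trans e1 e2

/-- The shell-pairs coming from a 2k-move. -/
def bl (N m : ℕ) : List (Endpoint × Endpoint) :=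
  (List.range m).map
    (fun j => (Endpoint.mk (N + 2 * j) false true, Endpoint.mk (N + (2 * j + 1)) true true))

theorem bl_succ (N m : ℕ) : bl N (m + 1) = bl N m ++
    [(Endpoint.mk (N + 2 * m) false true, Endpoint.mk (N + (2 * m + 1)) true true)] := by
  simp [bl, List.range_succ]

theorem PP_bl (N m : ℕ) : PP (bl N m) =
    (List.range (2 * m)).map (fun i => Endpoint.mk (N + i) (decide (i % 2 = 1)) true) := by
  induction m with
  | zero => rfl
  | succ m ih =>
    rw [bl_succ, PP_append, ih, show 2 * (m + 1) = 2 * m + 1 + 1 by ring, List.range_succ,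
      List.range_succ]
    simp [PP]

theorem QQ_bl (N m : ℕ) : QQ (bl N m) =
    (List.range (2 * m)).map (fun i => Endpoint.mk (N + i) (decide (i % 2 = 0)) true) := by
  induction m with
  | zero => rfl
  | succ m ih =>
    rw [bl_succ, QQ_append, ih, show 2 * (m + 1) = 2 * m + 1 + 1 by ring, List.range_succ,
      List.range_succ]
    simp [QQ, fl]

theorem labs_bl (N m : ℕ) : labs (bl N m) = (List.range (2 * m)).map (fun i => N + i) := by
  induction m with
  | zero => rfl
  | succ m ih =>
    rw [bl_succ, labs_append, ih, show 2 * (m + 1) = 2 * m + 1 + 1 by ring, List.range_succ,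
      List.range_succ]
    simp [labs]

theorem vl_gl (a : ℤ) : vl (gl a.natAbs (decide (0 < a))) = 2 * a := by
  rw [vl_uniform _ (decide (0 < a)) (by simp [gl])]
  by_cases h : 0 < a
  · simp [gl, h, abs_of_pos h]
  · simp [gl, h, abs_of_nonpos (not_lt.1 h)]

theorem vl_bl (N m : ℕ) : vl (bl N m) = 2 * m := by
  rw [vl_uniform _ true (by simp [bl])]
  simp [bl]

theorem E_shift {k : ℕ} (b : ℤ) : Rel2kXi k (Gword b) (Gword (b + k)) := by
  rw [Gword_eq b]
  set g := gl b.natAbs (decide (0 < b)) with hg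
  set N := 2 * b.natAbs with hN
  have hlg : labs g = List.range N := labs_gl _ _
  have hn : (labs (g ++ bl N k)).Nodup := by
    rw [labs_append, hlg, labs_bl, ← List.range_add]
    exact List.nodup_range
  have e1 : Rel2kXi k (W g) (W g ++ (PP (bl N k) ++ QQ (bl N k))) := by
    apply Relation.ReflTransGen.single
    right; right; left
    refine ⟨W g, [], [], fun i => N + i, true, ?_, ?_, ?_, by simp⟩
    · intro i _ j _ h
      simpa using h
    · intro i _
      simp [mem_W, hlg]
    · simp [PP_bl, QQ_bl]
  have e2 := E_PQ (k := k) (bl N k) (W g) (by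
    rw [labs_append] at hn; exact hn.of_append_right)
  rw [← W_append] at e2
  obtain ⟨a, a1, a2⟩ := toG (k := k) _ hn
  rw [vl_append, vl_bl, hg, vl_gl] at a1
  have : a = b + k := by omega
  rw [← this]
  exact E_trans e1 (E_trans e2 a2)

theorem E_shift_nat {k : ℕ} (b : ℤ) (n : ℕ) : Rel2kXi k (Gword b) (Gword (b + n * k)) := by
  induction n with
  | zero => simpa using E_refl _
  | succ n ih =>
    have := E_shift (k := k) (b + n * k)
    refine E_trans ih ?_
    rwa [show b + ((n + 1 : ℕ) : ℤ) * k = b + n * k + k by push_cast; ring]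

theorem E_shift_int {k : ℕ} (b n : ℤ) : Rel2kXi k (Gword b) (Gword (b + n * k)) := by
  obtain ⟨m, rfl | rfl⟩ := n.eq_nat_or_neg
  · exact E_shift_nat b m
  · have := E_shift_nat (k := k) (b + -(m : ℤ) * k) m
    rw [show b + -(m : ℤ) * k + m * k = b by ring] at this
    exact E_symm this

/-! ### Reduction of an arbitrary diagram to a shell word -/

/-- Convenient form of being a Gauss diagram. -/
def V (H : List Endpoint) : Prop :=
  ∀ e ∈ H, H.countP (fun x => x.label == e.label) = 2 ∧ fl e ∈ H

theorem V_perm {H H' : List Endpoint} (h : H.Perm H') (hV : V H) : V H' := by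
  intro e he
  obtain ⟨h1, h2⟩ := hV e (h.mem_iff.2 he)
  exact ⟨by rw [← h.countP_eq]; exact h1, h.mem_iff.1 h2⟩

theorem V_head {c : Endpoint} {H : List Endpoint} (hV : V (c :: fl c :: H)) :
    (∀ x ∈ H, x.label ≠ c.label) ∧ V H := by
  have h1 : ∀ x ∈ H, x.label ≠ c.label := by
    have := (hV c (by simp)).1
    simp only [List.countP_cons, fl_label, beq_self_eq_true, if_true] at this
    have h0 : H.countP (fun x => x.label == c.label) = 0 := by omega
    rw [List.countP_eq_zero] at h0
    intro x hx
    simpa using h0 x hx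
  refine ⟨h1, ?_⟩
  intro e he
  have hne := h1 e he
  obtain ⟨h2, h3⟩ := hV e (by simp [he])
  constructor
  · simpa [List.countP_cons, Ne.symm hne] using h2
  · rcases List.mem_cons.1 h3 with h | h
    · exact absurd (congrArg Endpoint.label h) hne
    · rcases List.mem_cons.1 h with h | h
      · exact absurd (congrArg Endpoint.label h) hne
      · exact h

theorem V_same {H : List Endpoint} (hV : V H) {A B : List Endpoint} {x y : Endpoint}
    (hH : H = A ++ x :: y :: B) (hxy : x.label = y.label) : y = fl x := by
  have hp : H.Perm (x :: y :: (A ++ B)) := by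
    rw [hH]
    exact List.perm_middle.trans (List.perm_middle.cons x)
  have hV' := V_perm hp hV
  obtain ⟨h1, h2⟩ := hV' x (by simp)
  simp only [List.countP_cons, hxy, beq_self_eq_true, if_true] at h1
  have h0 : (A ++ B).countP (fun z => z.label == y.label) = 0 := by omega
  rw [List.countP_eq_zero] at h0
  rcases List.mem_cons.1 h2 with h | h
  · have := congrArg Endpoint.isTerminal h
    simp at this
  · rcases List.mem_cons.1 h with h | h
    · exact h.symm
    · have := h0 _ h
      simp [hxy] at this

/-- The target of the reduction. -/
def Red (k : ℕ) (H : List Endpoint) : Prop :=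
  ∀ Z : List (Endpoint × Endpoint), (labs Z).Nodup → (∀ e ∈ H, e.label ∉ labs Z) →
    ∃ l, (labs l).Nodup ∧ Rel2kXi k (H ++ W Z) (W l)

theorem Red_xi {k : ℕ} (A B : List Endpoint) (x y z : Endpoint)
    (h1 : x.label ≠ y.label) (h2 : y.label ≠ z.label) (h3 : x.label ≠ z.label)
    (h : Red k (A ++ z :: y :: x :: B)) : Red k (A ++ x :: y :: z :: B) := by
  intro Z hZ hd
  obtain ⟨l, l1, l2⟩ := h Z hZ (by
    intro e he
    apply hd
    simp only [List.mem_append, List.mem_cons] at he ⊢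
    tauto)
  refine ⟨l, l1, E_trans ?_ l2⟩
  simpa using E_xi (k := k) A (B ++ W Z) x y z h1 h2 h3

theorem Red_r1 {k : ℕ} (A B : List Endpoint) (c : Endpoint)
    (hc : ∀ x ∈ A ++ B, x.label ≠ c.label)
    (h : Red k (A ++ B)) : Red k (A ++ c :: fl c :: B) := by
  intro Z hZ hd
  obtain ⟨l, l1, l2⟩ := h Z hZ (by
    intro e he
    apply hd
    simp only [List.mem_append, List.mem_cons] at he ⊢
    tauto)
  refine ⟨l, l1, E_trans ?_ l2⟩
  have := E_r1 (k := k) A (B ++ W Z) c (by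
    intro hm
    simp only [labels, List.map_append, List.mem_append] at hm
    have h2 : c.label ∉ (W Z).map Endpoint.label := by
      intro h3
      exact hd c (by simp) (mem_W.1 h3)
    rcases hm with hm | hm | hm
    · obtain ⟨x, hx, hxc⟩ := List.mem_map.1 hm
      exact hc x (by simp [hx]) hxc
    · obtain ⟨x, hx, hxc⟩ := List.mem_map.1 hm
      exact hc x (by simp [hx]) hxc
    · exact h2 hm)
  simpa using this

theorem Red_shell {k : ℕ} (B : List Endpoint) (c a : Endpoint) (hca : c.label ≠ a.label)
    (hc : ∀ x ∈ B, x.label ≠ c.label) (ha : ∀ x ∈ B, x.label ≠ a.label)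
    (h : Red k B) : Red k (c :: a :: fl c :: fl a :: B) := by
  intro Z hZ hd
  obtain ⟨l, l1, l2⟩ := h (Z ++ [(c, a)]) (by
    rw [labs_append, List.nodup_append]
    refine ⟨hZ, by simp [labs, hca], ?_⟩
    intro n hn m hm hnm
    subst hnm
    simp only [labs, List.mem_cons, List.not_mem_nil, or_false] at hm
    rcases hm with rfl | rfl
    · exact hd c (by simp) hn
    · exact hd a (by simp) hn) (by
    intro e he hm
    simp only [labs_append, List.mem_append, labs, List.mem_cons, List.not_mem_nil,
      or_false] at hm
    rcases hm with hm | hm | hm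
    · exact hd e (by simp [he]) hm
    · exact hc e he hm
    · exact ha e he hm)
  refine ⟨l, l1, E_trans ?_ l2⟩
  have := E_rot (k := k) [c, a, fl c, fl a] (B ++ W Z)
  simpa [W_append, W] using this

/-- Either some two adjacent endpoints share a label, or none do. -/
theorem Red_adj {k : ℕ} {n : ℕ} (ih : ∀ H : List Endpoint, H.length < n → V H → Red k H)
    (H : List Endpoint) (hn : H.length = n) (hV : V H)
    (h : (∀ A B x y, H = A ++ x :: y :: B → x.label ≠ y.label) → Red k H) : Red k H := by
  by_cases hadj : ∀ A B x y, H = A ++ x :: y :: B → x.label ≠ y.label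
  · exact h hadj
  · push Not at hadj
    obtain ⟨A, B, x, y, hH, hxy⟩ := hadj
    have hy := V_same hV hH hxy
    subst hy
    have hp : H.Perm (x :: fl x :: (A ++ B)) := by
      rw [hH]
      exact List.perm_middle.trans (List.perm_middle.cons x)
    obtain ⟨h1, h2⟩ := V_head (V_perm hp hV)
    have hlen := hp.length_eq
    rw [hH]
    refine Red_r1 A B x h1 (ih _ ?_ h2)
    simp only [List.length_cons] at hlen
    omega

theorem exists_last_two (M : List Endpoint) (h : 2 ≤ M.length) :
    ∃ M' a b, M = M' ++ [a, b] := by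
  rcases List.eq_nil_or_concat M with rfl | ⟨M1, b, rfl⟩
  · simp at h
  · rcases List.eq_nil_or_concat M1 with rfl | ⟨M2, a, rfl⟩
    · simp at h
    · exact ⟨M2, a, b, by simp⟩

theorem Red_second {k : ℕ} {n : ℕ} (ih : ∀ H : List Endpoint, H.length < n → V H → Red k H)
    (g : ℕ) : ∀ (c a : Endpoint) (N1 N2 : List Endpoint), N1.length = g →
    (c :: a :: fl c :: (N1 ++ fl a :: N2)).length = n →
    V (c :: a :: fl c :: (N1 ++ fl a :: N2)) →
    Red k (c :: a :: fl c :: (N1 ++ fl a :: N2)) := by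
  induction g using Nat.strong_induction_on with
  | _ g ihg =>
    intro c a N1 N2 hg hn hV
    refine Red_adj ih _ hn hV ?_
    intro hadj
    have hp : (c :: a :: fl c :: (N1 ++ fl a :: N2)).Perm
        (c :: fl c :: a :: fl a :: (N1 ++ N2)) := by
      refine List.Perm.cons _ ((List.Perm.swap _ _ _).trans ?_)
      exact (List.perm_middle.cons _).cons _
    obtain ⟨h1, h2⟩ := V_head (V_perm hp hV)
    obtain ⟨h3, h4⟩ := V_head h2
    have hca : c.label ≠ a.label := Ne.symm (h1 a (by simp))
    match N1, hg with
    | [], _ =>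
      refine Red_shell N2 c a hca (fun x hx => h1 x (by simp [hx])) (fun x hx => h3 x (by simp [hx]))
        (ih _ ?_ (by simpa using h4))
      rw [← hn]
      simp
      omega
    | [e], _ =>
      have hec := h1 e (by simp)
      have hea := h3 e (by simp)
      have := Red_xi (k := k) [c] (fl a :: N2) a (fl c) e hca.symm (Ne.symm hec) (Ne.symm hea)
      simp only [List.cons_append, List.nil_append] at this ⊢
      apply this
      have hp2 : (c :: a :: fl c :: ([e] ++ fl a :: N2)).Perm
          (c :: e :: fl c :: a :: fl a :: N2) := by
        refine List.Perm.cons _ ?_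
        simp only [List.cons_append, List.nil_append]
        exact (List.perm_append_comm_assoc [a, fl c] [e] _).trans
          ((List.Perm.swap _ _ _).cons _)
      have hV2 := V_perm hp2 hV
      have hn2 : (c :: e :: fl c :: a :: fl a :: N2).length = n := by
        rw [← hn]; simp
      refine Red_adj ih _ hn2 hV2 ?_
      intro h
      exact absurd rfl (h [c, e, fl c] N2 a (fl a) rfl)
    | e1 :: e2 :: N3, hg =>
      have h2l : 2 ≤ (e1 :: e2 :: N3).length := by simp
      generalize e1 :: e2 :: N3 = N1 at *
      obtain ⟨M, x, y, hM⟩ := exists_last_two N1 h2l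
      have hxm : x ∈ N1 := by rw [hM]; simp
      have hym : y ∈ N1 := by rw [hM]; simp
      have hxy := hadj (c :: a :: fl c :: M) (fl a :: N2) x y (by
        change c :: a :: fl c :: (N1 ++ fl a :: N2) = _
        rw [hM]; simp)
      have hya := h3 y (by
        change y ∈ N1 ++ N2
        simp [hym])
      have hxa := h3 x (by
        change x ∈ N1 ++ N2
        simp [hxm])
      have hx := Red_xi (k := k) (c :: a :: fl c :: M) N2 x y (fl a) hxy hya hxa
      have hp2 : (c :: a :: fl c :: (N1 ++ fl a :: N2)).Perm
          (c :: a :: fl c :: (M ++ fl a :: (y :: x :: N2))) := by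
        rw [hM]
        simp only [List.append_assoc, List.cons_append, List.nil_append]
        refine List.Perm.cons _ (List.Perm.cons _ (List.Perm.cons _ (List.Perm.append_left _ ?_)))
        exact (List.perm_append_comm_assoc [x, y] [fl a] N2).trans
          ((List.Perm.swap _ _ _).cons _)
      have hlt : M.length < g := by
        have := congrArg List.length hM
        simp only [List.length_append, List.length_cons, List.length_nil] at this hg
        omega
      have hfin := ihg M.length hlt c a M (y :: x :: N2) rfl (by rw [← hp2.length_eq]; exact hn)
        (V_perm hp2 hV)
      change Red k (c :: a :: fl c :: (N1 ++ fl a :: N2))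
      rw [hM]
      simpa using hx (by simpa using hfin)

theorem Red_first {k : ℕ} {n : ℕ} (ih : ∀ H : List Endpoint, H.length < n → V H → Red k H)
    (g : ℕ) : ∀ (c : Endpoint) (M N : List Endpoint), M.length = g →
    (c :: (M ++ fl c :: N)).length = n → V (c :: (M ++ fl c :: N)) →
    Red k (c :: (M ++ fl c :: N)) := by
  induction g using Nat.strong_induction_on with
  | _ g ihg =>
    intro c M N hg hn hV
    refine Red_adj ih _ hn hV ?_
    intro hadj
    have hp : (c :: (M ++ fl c :: N)).Perm (c :: fl c :: (M ++ N)) := List.perm_middle.cons _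
    obtain ⟨h1, h2⟩ := V_head (V_perm hp hV)
    match M, hg with
    | [], _ => exact absurd rfl (hadj [] N c (fl c) rfl)
    | [a], _ =>
      have hfa := (h2 a (by simp)).2
      have hm : fl a ∈ N := by
        rcases List.mem_cons.1 hfa with h | h
        · have := congrArg Endpoint.isTerminal h
          simp at this
        · exact h
      obtain ⟨N1, N2, rfl⟩ := List.append_of_mem hm
      exact Red_second ih N1.length c a N1 N2 rfl hn hV
    | e1 :: e2 :: M3, hg =>
      have h2l : 2 ≤ (e1 :: e2 :: M3).length := by simp
      generalize e1 :: e2 :: M3 = M0 at *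
      obtain ⟨M, x, y, hM⟩ := exists_last_two M0 h2l
      have hxm : x ∈ M0 := by rw [hM]; simp
      have hym : y ∈ M0 := by rw [hM]; simp
      have hxy := hadj (c :: M) (fl c :: N) x y (by
        change c :: (M0 ++ fl c :: N) = _
        rw [hM]; simp)
      have hyc := h1 y (by
        change y ∈ M0 ++ N
        simp [hym])
      have hxc := h1 x (by
        change x ∈ M0 ++ N
        simp [hxm])
      have hx := Red_xi (k := k) (c :: M) N x y (fl c) hxy hyc hxc
      have hp2 : (c :: (M0 ++ fl c :: N)).Perm (c :: (M ++ fl c :: (y :: x :: N))) := by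
        rw [hM]
        simp only [List.append_assoc, List.cons_append, List.nil_append]
        refine List.Perm.cons _ (List.Perm.append_left _ ?_)
        exact (List.perm_append_comm_assoc [x, y] [fl c] N).trans
          ((List.Perm.swap _ _ _).cons _)
      have hlt : M.length < g := by
        have := congrArg List.length hM
        simp only [List.length_append, List.length_cons, List.length_nil] at this hg
        omega
      have hfin := ihg M.length hlt c M (y :: x :: N) rfl (by rw [← hp2.length_eq]; exact hn)
        (V_perm hp2 hV)
      change Red k (c :: (M0 ++ fl c :: N))
      rw [hM]
      simpa using hx (by simpa using hfin)

theorem Red_all {k : ℕ} (n : ℕ) : ∀ H : List Endpoint, H.length = n → V H → Red k H := by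
  induction n using Nat.strong_induction_on with
  | _ n ih =>
    intro H hn hV
    cases H with
    | nil =>
      intro Z hZ _
      exact ⟨Z, hZ, E_refl _⟩
    | cons c H =>
      have hm : fl c ∈ H := by
        rcases List.mem_cons.1 (hV c (by simp)).2 with h | h
        · have := congrArg Endpoint.isTerminal h
          simp at this
        · exact h
      obtain ⟨M, N, rfl⟩ := List.append_of_mem hm
      exact Red_first (fun H hH => ih H.length hH H rfl) M.length c M N rfl hn hV

theorem V_of_gauss {G : List Endpoint} (hG : IsGaussDiagram G) : V G := by
  intro e he
  obtain ⟨h1, e', h2, h3, h4, h5⟩ := hG e he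
  refine ⟨by rw [List.countP_eq_length_filter]; exact h1, ?_⟩
  have : e' = fl e := by
    cases e'
    simp only at h3 h4 h5
    simp [fl, h3, h4, h5]
  exact this ▸ h2

end NormalForm

end Gauss

open Gauss in
/-- every virtual knot is related to `K(a)` for some `0 ≤ a < k`
by a finite sequence of 2k-moves and Ξ-moves (and Reidemeister moves). -/
theorem rel2kXi_normal_form (k : ℕ) (hk : 0 < k)
    (G : List Endpoint) (hG : IsGaussDiagram G) :
    ∃ a : ℤ, 0 ≤ a ∧ a < k ∧ Rel2kXi k G (Gword a) := by
  obtain ⟨l, l1, l2⟩ := Red_all (k := k) G.length G rfl (V_of_gauss hG) [] (by simp [labs])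
    (by simp [labs])
  obtain ⟨a, -, ha⟩ := toG (k := k) l l1
  have hk' : (0 : ℤ) < k := by exact_mod_cast hk
  refine ⟨a % k, Int.emod_nonneg _ hk'.ne', Int.emod_lt_of_pos _ hk', ?_⟩
  have h3 := E_shift_int (k := k) a (-(a / k))
  have h4 : a + -(a / k) * k = a % k := by
    rw [Int.emod_def]; ring
  rw [h4] at h3
  simp only [W, List.append_nil] at l2
  exact E_trans l2 (E_trans ha h3)
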